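/- arXiv:math/0606056 — 2 statements merged into one kernel-verified Lean document; each statement's English description precedes it below -/
import Mathlib

section
/- Let e_n denote the number of n×n linear derangements over 𝔽_q. Then the sequence e_n/γ_n converges as n → ∞, and lim_{n→∞} e_n/γ_n = ∏_{r≥1} (1 − q^{−r}) (an infinite product of real numbers). -/
/-- `gam q n` is the order of `GL_n(F_q)`: `∏_{i=0}^{n-1} (q^n - q^i)`. -/
def gam (q n : ℕ) : ℕ := ∏ i ∈ Finset.range n, (q ^ n - q ^ i)

/-- The number of `n × n` linear derangements over the field `F`, i.e. matrices `A`
such that both `A` and `A - 1` are invertible. -/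
noncomputable def linDerCount (F : Type) [Field F] [Fintype F] (n : ℕ) : ℕ :=
  Nat.card {A : Matrix (Fin n) (Fin n) F // IsUnit A ∧ IsUnit (A - 1)}

section GaussianIdentities

/-- The `k`-th coefficient `(-1)^k / ∏_{i=1}^k (x^i - 1)` in Euler's expansion. -/
noncomputable def eulerCoeff (x : ℝ) (k : ℕ) : ℝ :=
  ∏ i ∈ Finset.range k, (-(x ^ (i + 1) - 1)⁻¹)

theorem sum_eulerCoeff_mul_prod {x : ℝ} (hx : 1 < x) (y : ℝ) (n : ℕ) :
    ∑ k ∈ Finset.range (n + 1), eulerCoeff x k * ∏ i ∈ Finset.range k, (y - x ^ i) =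
      ∏ i ∈ Finset.range n, ((x ^ (i + 1) - y) * (x ^ (i + 1) - 1)⁻¹) := by
  have hprod (m : ℕ) :
      eulerCoeff x (m + 1) * ∏ i ∈ Finset.range (m + 1), (y - x ^ i) =
        (1 - y) * (x ^ (m + 1) - 1)⁻¹ *
          ∏ i ∈ Finset.range m, ((x ^ (i + 1) - y) * (x ^ (i + 1) - 1)⁻¹) := by
    rw [eulerCoeff, Finset.prod_range_succ, Finset.prod_range_succ' (fun i => y - x ^ i)]
    calc _ = (1 - y) * (x ^ (m + 1) - 1)⁻¹ * ((∏ i ∈ Finset.range m, (-(x ^ (i + 1) - 1)⁻¹)) *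
          ∏ i ∈ Finset.range m, (y - x ^ (i + 1))) := by ring
      _ = _ := by
        rw [← Finset.prod_mul_distrib]
        congr 1
        exact Finset.prod_congr rfl fun i _ => by ring
  induction n with
  | zero => simp [eulerCoeff]
  | succ n ih =>
    have hne : x ^ (n + 1) - 1 ≠ 0 := (sub_pos.2 (one_lt_pow₀ hx n.succ_ne_zero)).ne'
    rw [Finset.sum_range_succ, ih, hprod, Finset.prod_range_succ]
    field_simp
    ring

theorem sum_eulerCoeff_mul_prod_pow {x : ℝ} (hx : 1 < x) {n d : ℕ} (hd : d ≤ n) :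
    ∑ k ∈ Finset.range (n + 1), eulerCoeff x k * ∏ i ∈ Finset.range k, (x ^ d - x ^ i) =
      if d = 0 then 1 else 0 := by
  rw [sum_eulerCoeff_mul_prod hx]
  split_ifs with h
  · subst h
    refine Finset.prod_eq_one fun i _ => mul_inv_cancel₀ ?_
    simpa using (sub_pos.2 (one_lt_pow₀ hx i.succ_ne_zero)).ne'
  · refine Finset.prod_eq_zero (i := d - 1) (Finset.mem_range.2 (by omega)) ?_
    rw [Nat.sub_add_cancel (Nat.one_le_iff_ne_zero.2 h), sub_self, zero_mul]

theorem abs_eulerCoeff_le {x : ℝ} (hx : 2 ≤ x) (k : ℕ) :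
    |eulerCoeff x k| ≤ (k.factorial : ℝ)⁻¹ := by
  induction k with
  | zero => simp [eulerCoeff]
  | succ k ih =>
    have hb : ((k : ℝ) + 1) ≤ x ^ (k + 1) - 1 := by
      have h : k + 2 ≤ 2 ^ (k + 1) := Nat.lt_two_pow_self
      have h' : ((k : ℝ) + 2) ≤ 2 ^ (k + 1) := by exact_mod_cast h
      have := pow_le_pow_left₀ (by norm_num : (0 : ℝ) ≤ 2) hx (k + 1)
      linarith
    have hpos : (0 : ℝ) < k + 1 := by positivity
    rw [eulerCoeff, Finset.prod_range_succ, abs_mul, abs_neg, abs_inv,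
      abs_of_pos (hpos.trans_le hb), ← eulerCoeff, Nat.factorial_succ]
    push_cast
    rw [mul_inv_rev]
    exact mul_le_mul ih (inv_anti₀ hpos hb) (inv_pos.2 (hpos.trans_le hb)).le (by positivity)

theorem summable_eulerCoeff {x : ℝ} (hx : 2 ≤ x) : Summable fun k => |eulerCoeff x k| :=
  .of_nonneg_of_le (fun _ => abs_nonneg _) (abs_eulerCoeff_le hx)
    (by simpa using Real.summable_pow_div_factorial 1)

theorem summable_eulerCoeff_mul_pow {x : ℝ} (hx : 2 ≤ x) {z : ℝ} (hz : |z| ≤ 1) :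
    Summable fun k => eulerCoeff x k * z ^ k := by
  refine (summable_eulerCoeff hx).of_norm_bounded fun k => ?_
  rw [Real.norm_eq_abs, abs_mul, abs_pow]
  exact mul_le_of_le_one_right (abs_nonneg _) (pow_le_one₀ (abs_nonneg _) hz)

theorem tsum_eulerCoeff_mul_pow_eq {x : ℝ} (hx : 2 ≤ x) {z : ℝ} (hz : |z| ≤ 1) :
    ∑' k, eulerCoeff x k * z ^ k =
      (1 - x⁻¹ * z) * ∑' k, eulerCoeff x k * (x⁻¹ * z) ^ k := by
  have hx0 : 0 < x := by linarith
  have hz' : |x⁻¹ * z| ≤ 1 := by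
    rw [abs_mul, abs_of_pos (inv_pos.2 hx0)]
    exact mul_le_one₀ (inv_le_one_of_one_le₀ (by linarith)) (abs_nonneg _) hz
  have hs := summable_eulerCoeff_mul_pow hx hz
  have hs' := summable_eulerCoeff_mul_pow hx hz'
  have hterm (k : ℕ) : eulerCoeff x (k + 1) * z ^ (k + 1) =
      eulerCoeff x (k + 1) * (x⁻¹ * z) ^ (k + 1) -
        x⁻¹ * z * (eulerCoeff x k * (x⁻¹ * z) ^ k) := by
    have hne : x ^ (k + 1) - 1 ≠ 0 :=
      (sub_pos.2 (one_lt_pow₀ (by linarith) k.succ_ne_zero)).ne'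
    rw [eulerCoeff, Finset.prod_range_succ, ← eulerCoeff, mul_pow, mul_pow, inv_pow, inv_pow]
    field_simp
    ring
  rw [hs.tsum_eq_zero_add, tsum_congr hterm, Summable.tsum_sub ((summable_nat_add_iff 1).2 hs')
    (hs'.mul_left _), tsum_mul_left, sub_mul, one_mul]
  have h := hs'.tsum_eq_zero_add
  rw [pow_zero] at h ⊢
  linarith

theorem tsum_eulerCoeff {x : ℝ} (hx : 2 ≤ x) :
    ∑' k, eulerCoeff x k = ∏' r : ℕ, (1 - x⁻¹ ^ (r + 1)) := by
  have hx0 : 0 < x := by linarith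
  have hinv : |x⁻¹| < 1 := by
    rw [abs_of_pos (inv_pos.2 hx0)]
    exact inv_lt_one_of_one_lt₀ (by linarith)
  set f : ℝ → ℝ := fun z => ∑' k, eulerCoeff x k * z ^ k with hf
  have hiter (m : ℕ) : f 1 = (∏ r ∈ Finset.range m, (1 - x⁻¹ ^ (r + 1))) * f (x⁻¹ ^ m) := by
    induction m with
    | zero => simp
    | succ m ih =>
      rw [ih, Finset.prod_range_succ, mul_assoc, pow_succ' x⁻¹ m, hf]
      congr 1
      exact tsum_eulerCoeff_mul_pow_eq hx
        (by rw [abs_pow]; exact pow_le_one₀ (abs_nonneg _) hinv.le)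
  have hcont : ContinuousOn f (Set.Icc (-1) 1) := by
    refine continuousOn_tsum (fun k => by fun_prop) (summable_eulerCoeff hx) fun k z hz => ?_
    rw [Real.norm_eq_abs, abs_mul, abs_pow]
    exact mul_le_of_le_one_right (abs_nonneg _) (pow_le_one₀ (abs_nonneg _) (abs_le.2 hz))
  have hf0 : f 0 = 1 := by
    rw [hf]
    refine (tsum_eq_single 0 fun k hk => by simp [hk]).trans (by simp [eulerCoeff])
  have hlim : Filter.Tendsto (fun m : ℕ => f (x⁻¹ ^ m)) Filter.atTop (nhds 1) := by
    rw [← hf0]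
    exact (hcont.continuousAt (Icc_mem_nhds (by norm_num) (by norm_num))).tendsto.comp
      (tendsto_pow_atTop_nhds_zero_of_abs_lt_one hinv)
  have hmul : Multipliable fun r : ℕ => 1 - x⁻¹ ^ (r + 1) := by
    simp only [sub_eq_add_neg]
    exact Real.multipliable_one_add_of_summable
      ((summable_nat_add_iff 1).2 (summable_geometric_of_abs_lt_one hinv)).neg
  have h := hmul.hasProd.tendsto_prod_nat.mul hlim
  rw [mul_one] at h
  have := tendsto_nhds_unique (tendsto_const_nhds.congr hiter) h
  simpa [hf] using this

end GaussianIdentities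

section FixedVectors

variable {K V : Type*} [Field K] [AddCommGroup V] [Module K V]

theorem LinearIndependent.exists_linearEquiv_apply_eq [FiniteDimensional K V] {ι : Type*}
    {s t : ι → V} (hs : LinearIndependent K s) (ht : LinearIndependent K t) :
    ∃ g : V ≃ₗ[K] V, ∀ i, g (s i) = t i := by
  obtain ⟨g, hg⟩ := Submodule.exists_linearEquiv_restrict_eq
    ((Module.Basis.span hs).equiv (Module.Basis.span ht) (Equiv.refl ι))
  refine ⟨g, fun i => ?_⟩
  have h := hg (Module.Basis.span hs i)
  rw [Module.Basis.equiv_apply] at h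
  simpa using h.symm

/-- The general linear group acts on linearly independent families. -/
noncomputable abbrev linearIndependentMulAction (K V ι : Type*) [Field K] [AddCommGroup V]
    [Module K V] : MulAction (V ≃ₗ[K] V) {s : ι → V // LinearIndependent K s} where
  smul g s := ⟨fun i => g (s.1 i), s.2.map' g.toLinearMap g.ker⟩
  one_smul _ := rfl
  mul_smul _ _ _ := rfl

theorem card_linearIndependent_eq_prod_range [Fintype K] [Finite V] (k : ℕ) :
    (Nat.card {s : Fin k → V // LinearIndependent K s} : ℝ) =
      ∏ i ∈ Finset.range k,
        ((Fintype.card K : ℝ) ^ Module.finrank K V - (Fintype.card K : ℝ) ^ i) := by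
  obtain hk | hk := le_or_gt k (Module.finrank K V)
  · rw [card_linearIndependent hk, Fin.prod_univ_eq_prod_range
      (fun i => Fintype.card K ^ Module.finrank K V - Fintype.card K ^ i) k, Nat.cast_prod]
    refine Finset.prod_congr rfl fun i hi => ?_
    rw [Nat.cast_sub (Nat.pow_le_pow_right Fintype.card_pos
      ((Finset.mem_range.1 hi).le.trans hk))]
    push_cast
    rfl
  · have : IsEmpty {s : Fin k → V // LinearIndependent K s} :=
      ⟨fun s => by simpa using s.2.fintype_card_le_finrank.trans_lt hk⟩
    rw [Nat.card_of_isEmpty, Finset.prod_eq_zero (Finset.mem_range.2 hk) (sub_self _),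
      Nat.cast_zero]

theorem sum_prod_pow_finrank_ker_sub_one [Fintype K] [Finite V] [Fintype (V ≃ₗ[K] V)] {k : ℕ}
    (hk : k ≤ Module.finrank K V) :
    ∑ g : V ≃ₗ[K] V, ∏ i ∈ Finset.range k,
        ((Fintype.card K : ℝ) ^ Module.finrank K (LinearMap.ker (g.toLinearMap - 1)) -
          (Fintype.card K : ℝ) ^ i) =
      Fintype.card (V ≃ₗ[K] V) := by
  classical
  let X := {s : Fin k → V // LinearIndependent K s}
  let : MulAction (V ≃ₗ[K] V) X := linearIndependentMulAction K V (Fin k)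
  have : MulAction.IsPretransitive (V ≃ₗ[K] V) X := ⟨fun s t => by
    obtain ⟨g, hg⟩ := s.2.exists_linearEquiv_apply_eq t.2
    exact ⟨g, Subtype.ext (funext hg)⟩⟩
  have : Finite X := Subtype.finite
  have : Nonempty X :=
    ⟨⟨fun i => Module.finBasis K V (Fin.castLE hk i),
      (Module.finBasis K V).linearIndependent.comp _ (Fin.castLE_injective hk)⟩⟩
  let := Fintype.ofFinite (MulAction.orbitRel.Quotient (V ≃ₗ[K] V) X)
  let (g : V ≃ₗ[K] V) := Fintype.ofFinite (MulAction.fixedBy X g)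
  have hone : Fintype.card (MulAction.orbitRel.Quotient (V ≃ₗ[K] V) X) = 1 := by
    have := (MulAction.pretransitive_iff_subsingleton_quotient (V ≃ₗ[K] V) X).1 inferInstance
    exact Fintype.card_eq_one_iff_nonempty_unique.2
      ⟨⟨⟨Quotient.mk'' (Classical.arbitrary X)⟩, fun _ => Subsingleton.elim _ _⟩⟩
  have key := MulAction.sum_card_fixedBy_eq_card_orbits_mul_card_group (V ≃ₗ[K] V) X
  rw [hone, one_mul] at key
  rw [← key, Nat.cast_sum]
  refine Finset.sum_congr rfl fun g _ => ?_
  rw [← card_linearIndependent_eq_prod_range, ← Nat.card_eq_fintype_card]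
  congr 1
  have hmem (v : V) : v ∈ LinearMap.ker (g.toLinearMap - 1) ↔ g v = v := by
    simp [sub_eq_zero]
  exact Nat.card_congr
    { toFun s := ⟨⟨fun i => (s.1 i : V), s.2.map' (Submodule.subtype _) (Submodule.ker_subtype _)⟩,
        Subtype.ext (funext fun i => (hmem _).1 (s.1 i).2)⟩
      invFun s := ⟨fun i => ⟨s.1.1 i, (hmem _).2 (congrFun (congrArg Subtype.val s.2) i)⟩,
        .of_comp (Submodule.subtype _) s.1.2⟩
      left_inv _ := rfl
      right_inv _ := rfl }

theorem card_ker_sub_one_eq_bot_div_card [Fintype K] [Finite V] :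
    (Nat.card {g : V ≃ₗ[K] V // LinearMap.ker (g.toLinearMap - 1) = ⊥} : ℝ) /
        Nat.card (V ≃ₗ[K] V) =
      ∑ k ∈ Finset.range (Module.finrank K V + 1), eulerCoeff (Fintype.card K) k := by
  classical
  have : Finite (V ≃ₗ[K] V) := .of_injective _ DFunLike.coe_injective
  let := Fintype.ofFinite (V ≃ₗ[K] V)
  have hx : (1 : ℝ) < Fintype.card K := by exact_mod_cast Fintype.one_lt_card
  have hpos : (0 : ℝ) < Fintype.card (V ≃ₗ[K] V) := by exact_mod_cast Fintype.card_pos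
  rw [Nat.card_eq_fintype_card, Nat.card_eq_fintype_card, div_eq_iff hpos.ne', Finset.sum_mul,
    Fintype.card_subtype, Finset.card_filter, Nat.cast_sum]
  calc _ = ∑ g : V ≃ₗ[K] V, ∑ k ∈ Finset.range (Module.finrank K V + 1),
        eulerCoeff (Fintype.card K) k * ∏ i ∈ Finset.range k,
          ((Fintype.card K : ℝ) ^ Module.finrank K (LinearMap.ker (g.toLinearMap - 1)) -
            (Fintype.card K : ℝ) ^ i) := by
        refine Finset.sum_congr rfl fun g _ => ?_
        rw [sum_eulerCoeff_mul_prod_pow hx (Submodule.finrank_le _)]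
        simp [Submodule.finrank_eq_zero]
    _ = _ := by
        rw [Finset.sum_comm]
        refine Finset.sum_congr rfl fun k hk => ?_
        rw [← Finset.mul_sum, sum_prod_pow_finrank_ker_sub_one
          (Nat.lt_succ_iff.1 (Finset.mem_range.1 hk))]

end FixedVectors

section Matrices

variable (F : Type) [Field F] [Fintype F] (n : ℕ)

/-- Invertible matrices are linear automorphisms of the space of column vectors. -/
noncomputable def matrixGLEquivLinearEquiv :
    Matrix.GeneralLinearGroup (Fin n) F ≃* ((Fin n → F) ≃ₗ[F] (Fin n → F)) :=
  (Units.mapEquiv Matrix.toLinAlgEquiv'.toMulEquiv).trans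
    (LinearMap.GeneralLinearGroup.generalLinearEquiv F (Fin n → F))

theorem card_linearEquiv_eq_gam :
    Nat.card ((Fin n → F) ≃ₗ[F] (Fin n → F)) = gam (Fintype.card F) n := by
  rw [← Nat.card_congr (matrixGLEquivLinearEquiv F n).toEquiv, Matrix.card_GL_field, gam,
    Fin.prod_univ_eq_prod_range (fun i => Fintype.card F ^ n - Fintype.card F ^ i) n]

theorem linDerCount_eq_card_ker_sub_one_eq_bot :
    linDerCount F n = Nat.card {g : (Fin n → F) ≃ₗ[F] (Fin n → F) //
      LinearMap.ker (g.toLinearMap - 1) = ⊥} := by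
  have hiff (u : Matrix.GeneralLinearGroup (Fin n) F) : IsUnit (u.1 - 1) ↔
      LinearMap.ker ((matrixGLEquivLinearEquiv F n u).toLinearMap - 1) = ⊥ := by
    rw [← LinearMap.isUnit_iff_ker_eq_bot,
      ← MulEquiv.isUnit_map (Matrix.toLinAlgEquiv' (R := F) (n := Fin n)), map_sub, map_one]
    rfl
  rw [linDerCount, ← Nat.card_congr
    ((matrixGLEquivLinearEquiv F n).toEquiv.subtypeEquiv hiff)]
  exact Nat.card_congr
    { toFun A := ⟨A.2.1.unit, A.2.2⟩
      invFun u := ⟨u.1.1, u.1.isUnit, u.2⟩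
      left_inv _ := rfl
      right_inv _ := Subtype.ext (Units.ext rfl) }

end Matrices

theorem linDerCount_div_card_GL_tendsto {F : Type} [Field F] [Fintype F] (q : ℕ)
    (hq : Fintype.card F = q) :
    Filter.Tendsto (fun n : ℕ => (linDerCount F n : ℝ) / (gam q n : ℝ)) Filter.atTop
      (nhds (∏' r : ℕ, (1 - ((q : ℝ))⁻¹ ^ (r + 1)))) := by
  subst hq
  have hx : (2 : ℝ) ≤ Fintype.card F := by exact_mod_cast Fintype.one_lt_card (α := F)
  rw [← tsum_eulerCoeff hx]
  refine ((summable_eulerCoeff hx).of_abs.hasSum.tendsto_sum_nat.comp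
    (Filter.tendsto_add_atTop_nat 1)).congr fun n => ?_
  rw [linDerCount_eq_card_ker_sub_one_eq_bot, ← card_linearEquiv_eq_gam,
    card_ker_sub_one_eq_bot_div_card, Module.finrank_fin_fun]
  rfl
end

section
/- The number p_n of n×n projections over 𝔽_q (matrices P with P² = P) equals Σ_{i=0}^{n} γ_n/(γ_i · γ_{n−i}). -/
open Module LinearMap

theorem gam_pos {q : ℕ} (hq : 1 < q) (n : ℕ) : 0 < gam q n :=
  Finset.prod_pos fun _ hi =>
    Nat.sub_pos_of_lt (Nat.pow_lt_pow_right hq (Finset.mem_range.mp hi))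

section Projections

variable {K V A B : Type*} [Field K] [AddCommGroup V] [Module K V]
  [AddCommGroup A] [Module K A] [AddCommGroup B] [Module K B]

/-- An equivalence `A × B ≃ₗ V` carrying the projection onto `A` to `P` identifies `A` with the
range of `P`. -/
def equivRangeOfConj (P : End K V) (hP : IsIdempotentElem P) (e : (A × B) ≃ₗ[K] V)
    (he : ∀ x, P (e x) = e (x.1, 0)) : A ≃ₗ[K] range P where
  toFun a := ⟨e (a, 0), e (a, 0), he _⟩
  map_add' a b := by ext; simp [← map_add]
  map_smul' c a := by ext; simp [← map_smul]
  invFun v := (e.symm v).1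
  left_inv a := by simp
  right_inv v := by
    ext
    simp [← he, (hP.mem_range_iff).mp v.2]

/-- An equivalence `A × B ≃ₗ V` carrying the projection onto `A` to `P` identifies `B` with the
kernel of `P`. -/
def equivKerOfConj (P : End K V) (e : (A × B) ≃ₗ[K] V)
    (he : ∀ x, P (e x) = e (x.1, 0)) : B ≃ₗ[K] ker P where
  toFun b := ⟨e (0, b), by simp [he, ← Prod.zero_eq_mk]⟩
  map_add' a b := by ext; simp [← map_add]
  map_smul' c a := by ext; simp [← map_smul]
  invFun v := (e.symm v).2
  left_inv a := by simp
  right_inv v := by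
    ext
    have h : (e.symm v).1 = 0 := by
      have h := he (e.symm v)
      rw [e.apply_symm_apply, v.2, eq_comm, e.map_eq_zero_iff] at h
      exact congrArg Prod.fst h
    change e (0, (e.symm v).2) = v
    rw [← h, Prod.mk.eta, e.apply_symm_apply]

/-- Equivalences `A × B ≃ₗ V` carrying the projection onto `A` to the idempotent `P` are pairs of
equivalences of `A` with the range and of `B` with the kernel of `P`. -/
noncomputable def conjEquivProd (P : End K V) (hP : IsIdempotentElem P) :
    {e : (A × B) ≃ₗ[K] V // ∀ x, P (e x) = e (x.1, 0)} ≃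
      (A ≃ₗ[K] range P) × (B ≃ₗ[K] ker P) where
  toFun e := (equivRangeOfConj P hP e.1 e.2, equivKerOfConj P e.1 e.2)
  invFun fg := ⟨(fg.1.prodCongr fg.2).trans
      (Submodule.prodEquivOfIsCompl _ _ hP.isCompl), fun x => by
    simp [(hP.mem_range_iff).mp (fg.1 x.1).2]⟩
  left_inv e := by
    ext x
    change e.1 (x.1, 0) + e.1 (0, x.2) = e.1 x
    simp [← map_add]
  right_inv fg := by
    refine Prod.ext (LinearEquiv.ext fun a => Subtype.ext ?_)
      (LinearEquiv.ext fun b => Subtype.ext ?_)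
    · change ((fg.1 a : V) + (fg.2 0 : V)) = _
      simp
    · change ((fg.1 0 : V) + (fg.2 b : V)) = _
      simp

/-- Transport of the projection onto `A` along an equivalence `A × B ≃ₗ V`. -/
def conjProj (e : (A × B) ≃ₗ[K] V) : End K V :=
  e.conj (LinearMap.inl K A B ∘ₗ LinearMap.fst K A B)

theorem conjProj_apply (e : (A × B) ≃ₗ[K] V) (x : A × B) :
    conjProj e (e x) = e (x.1, 0) := by
  simp [conjProj, LinearEquiv.conj_apply]

theorem conjProj_eq_iff (e : (A × B) ≃ₗ[K] V) (P : End K V) :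
    conjProj e = P ↔ ∀ x, P (e x) = e (x.1, 0) := by
  refine ⟨fun h x => h ▸ conjProj_apply e x, fun h => LinearMap.ext fun v => ?_⟩
  obtain ⟨x, rfl⟩ := e.surjective v
  rw [h, conjProj_apply]

theorem isIdempotentElem_conjProj (e : (A × B) ≃ₗ[K] V) : IsIdempotentElem (conjProj e) := by
  refine LinearMap.ext fun v => ?_
  obtain ⟨x, rfl⟩ := e.surjective v
  rw [Module.End.mul_apply, conjProj_apply, conjProj_apply]

variable [Fintype K]

theorem card_linearEquiv_eq_gam_s7 [FiniteDimensional K V] [FiniteDimensional K A] {n : ℕ}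
    (hA : finrank K A = n) (hV : finrank K V = n) :
    Nat.card (A ≃ₗ[K] V) = gam (Fintype.card K) n := by
  let a : A ≃ₗ[K] (Fin n → K) := LinearEquiv.ofFinrankEq _ _ (by simp [hA])
  let v : V ≃ₗ[K] (Fin n → K) := LinearEquiv.ofFinrankEq _ _ (by simp [hV])
  have e : (A ≃ₗ[K] V) ≃ GL (Fin n) K :=
    Equiv.trans
      { toFun e := a.symm ≪≫ₗ e ≪≫ₗ v
        invFun e := a ≪≫ₗ e ≪≫ₗ v.symm
        left_inv e := by ext; simp
        right_inv e := LinearEquiv.ext fun x => by simp }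
      ((LinearMap.GeneralLinearGroup.generalLinearEquiv K (Fin n → K)).symm.toEquiv.trans
        Matrix.GeneralLinearGroup.toLin.symm.toEquiv)
  rw [Nat.card_congr e, Matrix.card_GL_field, gam, Finset.prod_range]

theorem card_idempotent_finrank_mul [FiniteDimensional K V] {n r : ℕ} (hV : finrank K V = n)
    (hr : r ≤ n) :
    Nat.card {P : End K V // IsIdempotentElem P ∧ finrank K (range P) = r} *
      (gam (Fintype.card K) r * gam (Fintype.card K) (n - r)) = gam (Fintype.card K) n := by
  have : Finite (End K V) := Module.finite_of_finite K
  have := Fintype.ofFinite {P : End K V // IsIdempotentElem P ∧ finrank K (range P) = r}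
  let f (e : ((Fin r → K) × (Fin (n - r) → K)) ≃ₗ[K] V) :
      {P : End K V // IsIdempotentElem P ∧ finrank K (range P) = r} :=
    ⟨conjProj e, isIdempotentElem_conjProj e, by
      rw [← (equivRangeOfConj _ (isIdempotentElem_conjProj e) e (conjProj_apply e)).finrank_eq,
        finrank_fin_fun]⟩
  have hf (P) : Nat.card {e // f e = P} =
      gam (Fintype.card K) r * gam (Fintype.card K) (n - r) := by
    have hk : finrank K (ker P.1) = n - r := by
      have := P.1.finrank_range_add_finrank_ker
      have := P.2.2
      omega
    rw [Nat.card_congr (Equiv.subtypeEquivRight fun e =>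
        Subtype.ext_iff.trans (conjProj_eq_iff e P.1)),
      Nat.card_congr (conjEquivProd P.1 P.2.1), Nat.card_prod,
      card_linearEquiv_eq_gam_s7 (finrank_fin_fun K) P.2.2,
      card_linearEquiv_eq_gam_s7 (finrank_fin_fun K) hk]
  have : Finite (((Fin r → K) × (Fin (n - r) → K)) →ₗ[K] V) := Module.finite_of_finite K
  have : Finite (((Fin r → K) × (Fin (n - r) → K)) ≃ₗ[K] V) :=
    Finite.of_injective _ LinearEquiv.toLinearMap_injective
  rw [← card_linearEquiv_eq_gam_s7 (A := (Fin r → K) × (Fin (n - r) → K)) (by simp [hr]) hV,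
    ← Nat.card_congr (Equiv.sigmaFiberEquiv f), Nat.card_sigma]
  simp [hf]

end Projections

theorem projectionCount_eq_sum {F : Type} [Field F] [Fintype F] (q : ℕ)
    (hq : Fintype.card F = q) (n : ℕ) :
    (Nat.card {P : Matrix (Fin n) (Fin n) F // P ^ 2 = P} : ℚ)
      = ∑ i ∈ Finset.range (n + 1), (gam q n : ℚ) / ((gam q i : ℚ) * (gam q (n - i) : ℚ)) := by
  classical
  subst hq
  have : Finite (End F (Fin n → F)) := Module.finite_of_finite F
  have := Fintype.ofFinite (End F (Fin n → F))
  have hcongr : Nat.card {P : Matrix (Fin n) (Fin n) F // P ^ 2 = P} =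
      Nat.card {P : End F (Fin n → F) // IsIdempotentElem P} :=
    Nat.card_congr (Matrix.toLinAlgEquiv'.toEquiv.subtypeEquiv fun P => by
      change _ ↔ Matrix.toLinAlgEquiv' P * Matrix.toLinAlgEquiv' P = Matrix.toLinAlgEquiv' P
      rw [← map_mul, EmbeddingLike.apply_eq_iff_eq, pow_two])
  have hrank (P : End F (Fin n → F)) : finrank F (range P) ∈ Finset.range (n + 1) := by
    have := P.range.finrank_le
    rw [finrank_fin_fun] at this
    exact Finset.mem_range_succ_iff.mpr this
  rw [hcongr, Nat.card_eq_fintype_card, Fintype.card_subtype,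
    Finset.card_eq_sum_card_fiberwise (fun P _ => hrank P), Nat.cast_sum]
  refine Finset.sum_congr rfl fun r hr => ?_
  have h := card_idempotent_finrank_mul (K := F) (finrank_fin_fun F)
    (Finset.mem_range_succ_iff.mp hr)
  have hpos := gam_pos (Fintype.one_lt_card (α := F))
  rw [Finset.filter_filter, ← Fintype.card_subtype, ← Nat.card_eq_fintype_card,
    eq_div_iff (by exact_mod_cast (Nat.mul_pos (hpos _) (hpos _)).ne')]
  exact_mod_cast h
end
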